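/- Let (τ,ω) be a standard-form biword with τ ∈ [m]^k, ω ∈ [n]^k, and RSK(τ,ω) = (P,Q). Let η ∈ [n]^k be the word obtained by listing, for each value t = 1, 2, …, m in increasing order, the row indices of the boxes of Q filled with t, in weakly decreasing order. Then η is obtained from ω by applying some finite sequence of raising operators e_i, and e_i(η) = NULL for all 1 ≤ i < n; that is, η is the highest weight of the connected crystal component containing ω. -/

import Mathlib

/-! # Common definitions: words, crystal operators, perforated tableaux, RSK -/

/-- `phiL i s` is 1 if the letter `s` equals `i`, else 0. -/
def phiL (i s : ℕ) : ℤ := if s = i then 1 else 0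

/-- `epsL i s` is 1 if the letter `s` equals `i+1`, else 0. -/
def epsL (i s : ℕ) : ℤ := if s = i + 1 then 1 else 0

/-- `c_e^i(w, j)`. -/
def ce (w : ℕ → ℕ) (i j : ℕ) : ℤ :=
  (∑ s ∈ Finset.Icc 1 j, epsL i (w s)) - (∑ s ∈ Finset.Icc 1 (j - 1), phiL i (w s))

/-- `c_f^i(w, j)` for a word of length `k`. -/
def cf (k : ℕ) (w : ℕ → ℕ) (i j : ℕ) : ℤ :=
  (∑ s ∈ Finset.Icc j k, phiL i (w s)) - (∑ s ∈ Finset.Icc (j + 1) k, epsL i (w s))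

/-- `E` is the value `ε_i(w)` (maximum of `c_e^i(w,j)` over `1 ≤ j ≤ k`). -/
def IsEps (k : ℕ) (w : ℕ → ℕ) (i : ℕ) (E : ℤ) : Prop :=
  (∃ j ∈ Finset.Icc 1 k, ce w i j = E) ∧ ∀ j ∈ Finset.Icc 1 k, ce w i j ≤ E

/-- `F` is the value `φ_i(w)` (maximum of `c_f^i(w,j)` over `1 ≤ j ≤ k`). -/
def IsPhi (k : ℕ) (w : ℕ → ℕ) (i : ℕ) (F : ℤ) : Prop :=
  (∃ j ∈ Finset.Icc 1 k, cf k w i j = F) ∧ ∀ j ∈ Finset.Icc 1 k, cf k w i j ≤ F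

/-- `Raises k i w w'` : `w' = e_i(w)` (in particular `e_i(w) ≠ NULL`). -/
def Raises (k i : ℕ) (w w' : ℕ → ℕ) : Prop :=
  ∃ E : ℤ, ∃ j : ℕ, IsEps k w i E ∧ j ∈ Finset.Icc 1 k ∧ ce w i j = E ∧
    (∀ j' ∈ Finset.Icc 1 k, ce w i j' = E → j ≤ j') ∧
    w j = i + 1 ∧ w' = Function.update w j i

/-- `Lowers k i w w'` : `w' = f_i(w)` (in particular `f_i(w) ≠ NULL`). -/
def Lowers (k i : ℕ) (w w' : ℕ → ℕ) : Prop :=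
  ∃ F : ℤ, ∃ j : ℕ, IsPhi k w i F ∧ j ∈ Finset.Icc 1 k ∧ cf k w i j = F ∧
    (∀ j' ∈ Finset.Icc 1 k, cf k w i j' = F → j' ≤ j) ∧
    w j = i ∧ w' = Function.update w j (i + 1)

/-- `w` is a word of length `k` in the alphabet `[n] = {1,…,n}`. -/
def IsWord (n k : ℕ) (w : ℕ → ℕ) : Prop := ∀ s ∈ Finset.Icc 1 k, w s ∈ Finset.Icc 1 n

/-- The number of letters of `w` (of length `k`) equal to `a`: component `a` of `wt(w)`. -/
def wtc (k : ℕ) (w : ℕ → ℕ) (a : ℕ) : ℕ :=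
  ((Finset.Icc 1 k).filter (fun s => w s = a)).card

/-- The biword `(τ, ω)` of length `k` is in standard form. -/
def StdForm (k : ℕ) (τ ω : ℕ → ℕ) : Prop :=
  (∀ j, 1 ≤ j → j < k → τ j ≤ τ (j + 1)) ∧
  (∀ j, 1 ≤ j → j < k → τ j = τ (j + 1) → ω (j + 1) ≤ ω j)

/-- One application of some raising operator `e_i`, `1 ≤ i < n`. -/
def RaiseStep (n k : ℕ) (w w' : ℕ → ℕ) : Prop := ∃ i, 1 ≤ i ∧ i < n ∧ Raises k i w w'

/-- `η` is a highest weight of `w`: obtained from `w` by finitely many raising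
operators, and no raising operator applies to `η`. -/
def HighestOf (n k : ℕ) (w η : ℕ → ℕ) : Prop :=
  Relation.ReflTransGen (RaiseStep n k) w η ∧ ∀ i, 1 ≤ i → i < n → ¬∃ η', Raises k i η η'

/-! ## Perforated tableaux -/

/-- A rectangular array of optionally-filled boxes, indexed by (row, column), 1-based. -/
abbrev Arr : Type := ℕ → ℕ → Option ℕ

/-- Conditions (i) and (ii) for a perforated tableau with `n` rows, content in `[m]`,
`ℓ` columns (together with confinement of the filled boxes to the grid). -/
def PCond (n m ℓ : ℕ) (E : Arr) : Prop :=
  (∀ r c a, E r c = some a → 1 ≤ r ∧ r ≤ n ∧ 1 ≤ c ∧ c ≤ ℓ ∧ 1 ≤ a ∧ a ≤ m) ∧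
  (∀ i r r' c, E r c = some i → E r' c = some i → r = r') ∧
  (∀ i r c r' c', E r c = some i → E r' c' = some i → c < c' → r' ≤ r) ∧
  (∀ i j r c r' c', i < j → E r c = some i → E r' c' = some j → r ≤ r' ∧ c ≤ c')

/-- The number of boxes of `E` (with `ℓ` columns) filled with `a` lying in row `r`. -/
def cnt (ℓ : ℕ) (E : Arr) (a r : ℕ) : ℕ :=
  ((Finset.Icc 1 ℓ).filter (fun c => E r c = some a)).card

/-- `E` is a perforated tableau with `n` rows, content in `[m]` and `ℓ` columns:
conditions (i), (ii) hold and `ℓ` is minimal for the given (value, row) multiplicities. -/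
def IsPTab (n m ℓ : ℕ) (E : Arr) : Prop :=
  PCond n m ℓ E ∧
  ∀ ℓ' (E' : Arr), PCond n m ℓ' E' → (∀ a r, cnt ℓ' E' a r = cnt ℓ E a r) → ℓ ≤ ℓ'

/-- One swap of a blank box with a horizontally adjacent filled box in the same row,
both `E` and the result `E'` being valid ptableaux. -/
def SwapStep (n m ℓ : ℕ) (E E' : Arr) : Prop :=
  IsPTab n m ℓ E ∧ IsPTab n m ℓ E' ∧
  ∃ r c,
    ((E r c = none ∧ E r (c + 1) ≠ none ∧ E' r c = E r (c + 1) ∧ E' r (c + 1) = none) ∨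
     (E r (c + 1) = none ∧ E r c ≠ none ∧ E' r (c + 1) = E r c ∧ E' r c = none)) ∧
    ∀ r' c', ¬(r' = r ∧ (c' = c ∨ c' = c + 1)) → E' r' c' = E r' c'

/-- Row-equivalence of ptableaux: finitely many swap steps. -/
def RowEquiv (n m ℓ : ℕ) : Arr → Arr → Prop := Relation.ReflTransGen (SwapStep n m ℓ)

/-- Number of filled boxes in row `r` among columns `1..c` (inclusive). -/
def filledUpTo (E : Arr) (r c : ℕ) : ℕ :=
  ((Finset.Icc 1 c).filter (fun c' => E r c' ≠ none)).card

/-- `E` is left-justified: its filled boxes lie weakly to the left of the corresponding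
boxes of any row-equivalent ptableau. -/
def LeftJust (n m ℓ : ℕ) (E : Arr) : Prop :=
  IsPTab n m ℓ E ∧ ∀ E', RowEquiv n m ℓ E E' → ∀ r c, filledUpTo E' r c ≤ filledUpTo E r c

/-- `E` is right-justified. -/
def RightJust (n m ℓ : ℕ) (E : Arr) : Prop :=
  IsPTab n m ℓ E ∧ ∀ E', RowEquiv n m ℓ E E' → ∀ r c, filledUpTo E r c ≤ filledUpTo E' r c

/-- Number of blank boxes in row `r`, among columns `1..ℓ`. -/
def blanksInRow (ℓ : ℕ) (E : Arr) (r : ℕ) : ℕ :=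
  ((Finset.Icc 1 ℓ).filter (fun c => E r c = none)).card

/-- `G` (with `ℓ2` columns) is the left-justified form `^*T[i,i+1]` of the two-row
ptableau formed by rows `i`, `i+1` of `E` (a ptableau with `ℓ` columns). -/
def IsLJ2 (m ℓ : ℕ) (E : Arr) (i : ℕ) (G : Arr) (ℓ2 : ℕ) : Prop :=
  IsPTab 2 m ℓ2 G ∧ LeftJust 2 m ℓ2 G ∧
  ∀ a, cnt ℓ2 G a 1 = cnt ℓ E a i ∧ cnt ℓ2 G a 2 = cnt ℓ E a (i + 1)

/-- `H` (with `ℓ2` columns) is the right-justified form `T[i,i+1]^*`. -/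
def IsRJ2 (m ℓ : ℕ) (E : Arr) (i : ℕ) (H : Arr) (ℓ2 : ℕ) : Prop :=
  IsPTab 2 m ℓ2 H ∧ RightJust 2 m ℓ2 H ∧
  ∀ a, cnt ℓ2 H a 1 = cnt ℓ E a i ∧ cnt ℓ2 H a 2 = cnt ℓ E a (i + 1)

/-- `PRaises n m ℓ i E E'` : `E' = e_i(E)` for ptableaux.  In `^*E[i,i+1]` the
right-most filled bottom box with a blank above it is located (column `c2`), and the
corresponding box of row `i+1` of `E` (column `c0`, same index from the left among
filled boxes of the row) is moved up into the blank above it. -/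
def PRaises (n m ℓ i : ℕ) (E E' : Arr) : Prop :=
  IsPTab n m ℓ E ∧
  ∃ (G : Arr) (ℓ2 c2 c0 : ℕ), IsLJ2 m ℓ E i G ℓ2 ∧
    c2 ∈ Finset.Icc 1 ℓ2 ∧ G 2 c2 ≠ none ∧ G 1 c2 = none ∧
    (∀ c', c' ∈ Finset.Icc 1 ℓ2 → G 2 c' ≠ none → G 1 c' = none → c' ≤ c2) ∧
    c0 ∈ Finset.Icc 1 ℓ ∧ E (i + 1) c0 ≠ none ∧ E i c0 = none ∧
    filledUpTo E (i + 1) c0 = filledUpTo G 2 c2 ∧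
    E' = fun r c =>
      if r = i ∧ c = c0 then E (i + 1) c0
      else if r = i + 1 ∧ c = c0 then none
      else E r c

/-- `PLowers n m ℓ i E E'` : `E' = f_i(E)` for ptableaux. -/
def PLowers (n m ℓ i : ℕ) (E E' : Arr) : Prop :=
  IsPTab n m ℓ E ∧
  ∃ (H : Arr) (ℓ2 c2 c0 : ℕ), IsRJ2 m ℓ E i H ℓ2 ∧
    c2 ∈ Finset.Icc 1 ℓ2 ∧ H 1 c2 ≠ none ∧ H 2 c2 = none ∧
    (∀ c', c' ∈ Finset.Icc 1 ℓ2 → H 1 c' ≠ none → H 2 c' = none → c2 ≤ c') ∧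
    c0 ∈ Finset.Icc 1 ℓ ∧ E i c0 ≠ none ∧ E (i + 1) c0 = none ∧
    filledUpTo E i c0 = filledUpTo H 1 c2 ∧
    E' = fun r c =>
      if r = i + 1 ∧ c = c0 then E i c0
      else if r = i ∧ c = c0 then none
      else E r c

/-- A ptableau is highest weight when no raising operator applies. -/
def PHighest (n m ℓ : ℕ) (E : Arr) : Prop :=
  ∀ i, 1 ≤ i → i < n → ¬∃ E', PRaises n m ℓ i E E'

/-- One application of some ptableau raising operator `e_i`, `1 ≤ i < n`. -/
def PRaiseStep (n m ℓ : ℕ) (E E' : Arr) : Prop :=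
  ∃ i, 1 ≤ i ∧ i < n ∧ PRaises n m ℓ i E E'

/-- One application of some ptableau crystal operator `e_i` or `f_i`, `1 ≤ i < n`. -/
def PStep (n m ℓ : ℕ) (E E' : Arr) : Prop :=
  ∃ i, 1 ≤ i ∧ i < n ∧ (PRaises n m ℓ i E E' ∨ PLowers n m ℓ i E E')

/-- Number of columns `s ∈ {1,…,k}` of the biword `(τ, ω)` equal to `(a, r)`. -/
def countPairs (k : ℕ) (τ ω : ℕ → ℕ) (a r : ℕ) : ℕ :=
  ((Finset.Icc 1 k).filter (fun s => τ s = a ∧ ω s = r)).card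

/-- `E = Perf(τ, ω)` (up to row-equivalence): the ptableau with a box filled with
`τ_s` in row `ω_s` for each `s`. -/
def IsPerf (n m k ℓ : ℕ) (τ ω : ℕ → ℕ) (E : Arr) : Prop :=
  IsPTab n m ℓ E ∧ ∀ a r, cnt ℓ E a r = countPairs k τ ω a r

/-- A (left-justified) array is a semistandard Young tableau: partition shape,
rows weakly increasing, columns strictly increasing. -/
def IsSSYT (E : Arr) : Prop :=
  (∀ r c, 1 ≤ c → E r (c + 1) ≠ none → E r c ≠ none) ∧
  (∀ r c, 1 ≤ r → E (r + 1) c ≠ none → E r c ≠ none) ∧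
  (∀ r c c' a b, c ≤ c' → E r c = some a → E r c' = some b → a ≤ b) ∧
  (∀ r r' c a b, r < r' → E r c = some a → E r' c = some b → a < b)

/-- `D` (with `m` rows, content in `[n]`, `ℓd` columns) is the dual of the ptableau `E`
(with `n` rows, content in `[m]`, `ℓ` columns): for each box of `E` filled with `i` in
row `j`, `D` has a box filled with `j` in row `i` (with multiplicity). -/
def IsDualOf (n m ℓ ℓd : ℕ) (E D : Arr) : Prop :=
  IsPTab n m ℓ E ∧ IsPTab m n ℓd D ∧ ∀ v r, cnt ℓd D v r = cnt ℓ E r v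

/-- Rotation by 180° composed with the value flip `j ↦ m + 1 − j`. -/
def RotArr (n m ℓ : ℕ) (E : Arr) : Arr :=
  fun r c => (E (n + 1 - r) (ℓ + 1 - c)).map (fun j => m + 1 - j)

/-- The word condition for a ptableau with `n` rows. -/
def WordCond (n ℓ : ℕ) (E : Arr) : Prop :=
  ∀ i k, 1 ≤ i → i + 1 ≤ n →
    ∑ r ∈ Finset.Icc (i + 1) (i + k + 1), cnt ℓ E (i + 1) r ≤
      ∑ r ∈ Finset.Icc i (i + k), cnt ℓ E i r

/-- `s'` is the value of the nearest filled box strictly above row `k` in column `col`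
of `R` (`s' = 0` if there is no filled box above). -/
def NearestAbove (R : Arr) (k col s' : ℕ) : Prop :=
  (s' = 0 ∧ ∀ r, r < k → R r col = none) ∨
  (∃ r, r < k ∧ R r col = some s' ∧ ∀ r', r < r' → r' < k → R r' col = none)

/-! ## Classic RSK via Schensted column insertion (tableaux stored as lists of columns) -/

/-- Insert `x` into a single column (stored top-to-bottom): replace the topmost entry
`≥ x` by `x`, returning the bumped entry; if none, append `x` at the bottom. -/
def bumpCol (x : ℕ) : List ℕ → Option ℕ × List ℕ
  | [] => (none, [x])
  | z :: rest =>
    if x ≤ z then (some z, x :: rest)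
    else
      let p := bumpCol x rest
      (p.1, z :: p.2)

/-- Column-insert `x` into a tableau stored as a list of columns (left to right). -/
def insertTab : List (List ℕ) → ℕ → List (List ℕ)
  | [], x => [[x]]
  | col :: rest, x =>
    match bumpCol x col with
    | (none, col') => col' :: rest
    | (some z, col') => col' :: insertTab rest z

/-- Grow the recording tableau `q` by placing `t` in the box where `pNew` grew from `pOld`. -/
def growQ : List (List ℕ) → List (List ℕ) → List (List ℕ) → ℕ → List (List ℕ)
  | pc :: pr, nc :: nr, qc :: qr, t =>
    if pc.length < nc.length then (qc ++ [t]) :: qr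
    else qc :: growQ pr nr qr t
  | _, _, q, t => q ++ [[t]]

/-- One step of RSK: insert the biword column `tx = (τ_j, ω_j)`. -/
def rskStep (pq : List (List ℕ) × List (List ℕ)) (tx : ℕ × ℕ) :
    List (List ℕ) × List (List ℕ) :=
  let P' := insertTab pq.1 tx.2
  (P', growQ pq.1 P' pq.2 tx.1)

/-- Classic RSK of a biword given as a list of columns `(τ_j, ω_j)`:
returns the pair (insertion tableau `P`, recording tableau `Q`), each stored
as a list of columns. -/
def rsk (bw : List (ℕ × ℕ)) : List (List ℕ) × List (List ℕ) :=
  bw.foldl rskStep ([], [])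

/-- The list `[(τ 1, ω 1), …, (τ k, ω k)]` of columns of a biword. -/
def bwList (k : ℕ) (τ ω : ℕ → ℕ) : List (ℕ × ℕ) :=
  (List.range k).map (fun j => (τ (j + 1), ω (j + 1)))

/-- The entry in row `r`, column `c` (1-based) of a tableau stored as a list of columns. -/
def tabEntry (cols : List (List ℕ)) : Arr := fun r c =>
  if 1 ≤ r ∧ 1 ≤ c then (cols.getD (c - 1) [])[r - 1]? else none

/-! ### Signatures of words -/

/-- The number of unmatched letters `i + 1` of a word, where each `i` is matched with a later
`i + 1`. -/
def sigEps (i : ℕ) : List ℕ → ℕ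
  | [] => 0
  | a :: l => if a = i + 1 then sigEps i l + 1 else if a = i then sigEps i l - 1 else sigEps i l

/-- The number of unmatched letters `i` of a word, where each `i` is matched with a later
`i + 1`. -/
def sigPhi (i : ℕ) : List ℕ → ℕ
  | [] => 0
  | a :: l => if a = i then sigPhi i l + (1 - sigEps i l) else sigPhi i l

/-- `u'` arises from `u` by replacing the last unmatched `i + 1` by `i`. -/
def ListRaises (i : ℕ) (u u' : List ℕ) : Prop :=
  ∃ p q, u = p ++ (i + 1) :: q ∧ u' = p ++ i :: q ∧ sigPhi i p = 0 ∧ sigEps i q = 0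

theorem sigEps_append (i : ℕ) (u v : List ℕ) :
    sigEps i (u ++ v) = sigEps i u + (sigEps i v - sigPhi i u) := by
  induction u with
  | nil => simp [sigEps, sigPhi]
  | cons a u ih =>
    simp only [List.cons_append, sigEps, sigPhi, ih]
    split_ifs <;> omega

theorem sigPhi_append (i : ℕ) (u v : List ℕ) :
    sigPhi i (u ++ v) = sigPhi i v + (sigPhi i u - sigEps i v) := by
  induction u with
  | nil => simp [sigPhi]
  | cons a u ih =>
    simp only [List.cons_append, sigPhi, ih, sigEps_append]
    split_ifs <;> omega

theorem sigEps_eq_zero_of_forall_lt {i : ℕ} {l : List ℕ} (h : ∀ a ∈ l, i + 1 < a) :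
    sigEps i l = 0 := by
  induction l with
  | nil => rfl
  | cons a l ih =>
    rw [List.forall_mem_cons] at h
    have := ih h.2
    grind [sigEps]

theorem sigPhi_eq_zero_of_forall_lt {i : ℕ} {l : List ℕ} (h : ∀ a ∈ l, i < a) :
    sigPhi i l = 0 := by
  induction l with
  | nil => rfl
  | cons a l ih =>
    rw [List.forall_mem_cons] at h
    have := ih h.2
    grind [sigPhi]

theorem listRaises_append_iff {i : ℕ} {a a' u u' : List ℕ} (h : a.length = a'.length) :
    ListRaises i (a ++ u) (a' ++ u') ↔
      (a = a' ∧ ListRaises i u u' ∧ sigPhi i a < sigEps i u) ∨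
        (u = u' ∧ ListRaises i a a' ∧ sigEps i u ≤ sigPhi i a) := by
  constructor
  · rintro ⟨p, q, h1, h2, h3, h4⟩
    rcases List.append_eq_append_iff.1 h1 with ⟨c, rfl, rfl⟩ | ⟨c, rfl, h5⟩
    · rw [List.append_assoc] at h2
      obtain ⟨rfl, rfl⟩ := List.append_inj h2 h.symm
      refine Or.inl ⟨rfl, ⟨c, q, rfl, rfl, ?_, h4⟩, ?_⟩
      all_goals
        simp only [sigEps_append, sigPhi_append, sigEps, if_true] at *
        omega
    · cases c with
      | nil =>
        simp only [List.nil_append, List.append_nil] at *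
        subst h5
        obtain ⟨rfl, rfl⟩ := List.append_inj h2 h.symm
        refine Or.inl ⟨rfl, ⟨[], q, rfl, rfl, rfl, h4⟩, ?_⟩
        simp [sigEps, h3]
      | cons b c =>
        simp only [List.cons_append, List.cons.injEq] at h5
        obtain ⟨rfl, rfl⟩ := h5
        have h6 : a' ++ u' = (p ++ i :: c) ++ u := by simpa using h2
        obtain ⟨rfl, rfl⟩ := List.append_inj h6 (by simp at h ⊢; omega)
        refine Or.inr ⟨rfl, ⟨p, c, rfl, rfl, h3, ?_⟩, ?_⟩
        all_goals
          simp only [sigEps_append, sigPhi_append, sigPhi] at *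
          grind
  · rintro (⟨rfl, ⟨p, q, rfl, rfl, h3, h4⟩, h5⟩ | ⟨rfl, ⟨p, q, rfl, rfl, h3, h4⟩, h5⟩)
    · refine ⟨a ++ p, q, by simp, by simp, ?_, h4⟩
      simp only [sigEps_append, sigPhi_append, sigEps, if_true] at *
      omega
    · refine ⟨p, q ++ u, by simp, by simp, h3, ?_⟩
      simp only [sigEps_append, sigPhi_append, sigPhi] at *
      split_ifs at * <;> omega

theorem listRaises_cons_iff {i a b : ℕ} {u v : List ℕ} :
    ListRaises i (a :: u) (b :: v) ↔
      (a = i + 1 ∧ b = i ∧ u = v ∧ sigEps i u = 0) ∨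
        (a = b ∧ ListRaises i u v ∧ (if a = i then 1 else 0) < sigEps i u) := by
  constructor
  · rintro ⟨p, q, h1, h2, h3, h4⟩
    cases p with
    | nil => simp_all
    | cons c p =>
      simp only [List.cons_append, List.cons.injEq] at h1 h2
      obtain ⟨rfl, rfl⟩ := h1
      obtain ⟨rfl, rfl⟩ := h2
      refine Or.inr ⟨rfl, ⟨p, q, rfl, rfl, ?_, h4⟩, ?_⟩
      all_goals
        simp only [sigPhi, sigEps_append, sigEps, if_true] at *
        split_ifs at * <;> omega
  · rintro (⟨rfl, rfl, rfl, h⟩ | ⟨rfl, h, h'⟩)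
    · exact ⟨[], u, rfl, rfl, rfl, h⟩
    · have := (listRaises_append_iff (a := [a]) (a' := [a]) (u := u) (u' := v) (i := i) rfl).2
        (Or.inl ⟨rfl, h, by simpa [sigPhi, sigEps] using h'⟩)
      simpa using this

theorem not_listRaises_nil {i : ℕ} {u : List ℕ} : ¬ ListRaises i [] u := by
  rintro ⟨p, q, h, -⟩
  simp at h

theorem listRaises_singleton_iff {i a b : ℕ} :
    ListRaises i [a] [b] ↔ a = i + 1 ∧ b = i := by
  simp [listRaises_cons_iff, not_listRaises_nil, sigEps]

namespace ListRaises

variable {i : ℕ} {u u' : List ℕ}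

theorem mem_right (h : ListRaises i u u') : i ∈ u' := by
  obtain ⟨p, q, -, rfl, -⟩ := h
  simp

theorem sigEps_pos (h : ListRaises i u u') : 0 < sigEps i u := by
  obtain ⟨p, q, rfl, rfl, h3, h4⟩ := h
  simp [sigEps_append, sigEps, h3]

end ListRaises

/-! ### Bumping into a column -/

theorem mem_of_mem_bumpCol {x a : ℕ} {C : List ℕ} (h : a ∈ (bumpCol x C).2) : a = x ∨ a ∈ C := by
  induction C with
  | nil => simpa [bumpCol] using h
  | cons z C ih => grind [bumpCol]

theorem bumpCol_pairwise {x : ℕ} {C : List ℕ} (h : C.Pairwise (· < ·)) :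
    (bumpCol x C).2.Pairwise (· < ·) := by
  induction C with
  | nil => simp [bumpCol]
  | cons z C ih =>
    rw [List.pairwise_cons] at h
    by_cases hx : x ≤ z
    · simp only [bumpCol, hx, if_true, List.pairwise_cons]
      exact ⟨fun a ha => by have := h.1 a ha; omega, h.2⟩
    · simp only [bumpCol, hx, if_false, List.pairwise_cons]
      refine ⟨fun a ha => ?_, ih h.2⟩
      rcases mem_of_mem_bumpCol ha with rfl | ha
      · omega
      · exact h.1 a ha

theorem bumpCol_eq_some {x y : ℕ} {C : List ℕ} (h : (bumpCol x C).1 = some y) :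
    x ≤ y ∧ y ∈ C ∧ ∃ d D, (bumpCol x C).2 = d :: D ∧ d ≤ y := by
  induction C with
  | nil => simp [bumpCol] at h
  | cons z C ih => grind [bumpCol]

theorem bumpCol_length (x : ℕ) (C : List ℕ) :
    (bumpCol x C).2.length + (bumpCol x C).1.toList.length = C.length + 1 := by
  induction C with
  | nil => simp [bumpCol]
  | cons z C ih => grind [bumpCol]

theorem sig_bumpCol (i x : ℕ) {C : List ℕ} (h : C.Pairwise (· < ·)) :
    sigEps i ((bumpCol x C).1.toList ++ (bumpCol x C).2) = sigEps i (C ++ [x]) ∧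
      sigPhi i ((bumpCol x C).1.toList ++ (bumpCol x C).2) = sigPhi i (C ++ [x]) := by
  induction C with
  | nil => simp [bumpCol]
  | cons z C ih =>
    rw [List.pairwise_cons] at h
    have ih := ih h.2
    by_cases hx : x ≤ z
    · simp only [bumpCol, hx, if_true, Option.toList_some, List.cons_append, List.nil_append]
      cases C with
      | nil => grind [sigEps, sigPhi]
      | cons r C =>
        have h3 : z < r := h.1 r (by simp)
        have hr := (List.pairwise_cons.1 h.2).1
        have h1 : i ≤ z → sigEps i C = 0 := fun hi =>
          sigEps_eq_zero_of_forall_lt fun a ha => by have := hr a ha; omega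
        have h2 : i ≤ z → sigPhi i C = 0 := fun hi =>
          sigPhi_eq_zero_of_forall_lt fun a ha => by have := hr a ha; omega
        simp only [List.cons_append, sigEps, sigPhi, sigEps_append, sigPhi_append]
        grind
    · simp only [bumpCol, hx, if_false, List.cons_append]
      rcases hb : (bumpCol x C).1 with _ | y
      · simp only [hb, Option.toList_none, List.nil_append] at ih ⊢
        simp only [sigEps, sigPhi, ih, and_self]
      · obtain ⟨hy, hyC, d, D, hD, hd⟩ := bumpCol_eq_some hb
        have hp := bumpCol_pairwise (x := x) h.2
        have hz : z < d := by
          rcases mem_of_mem_bumpCol (x := x) (a := d) (C := C) (by simp [hD]) with rfl | hd'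
          · omega
          · exact h.1 d hd'
        rw [hD, List.pairwise_cons] at hp
        have h1 : i ≤ z → sigEps i D = 0 := fun hi =>
          sigEps_eq_zero_of_forall_lt fun a ha => by grind
        have h2 : i ≤ z → sigPhi i D = 0 := fun hi =>
          sigPhi_eq_zero_of_forall_lt fun a ha => by grind
        simp only [hb, hD, Option.toList_some, List.cons_append, List.nil_append] at ih ⊢
        simp only [sigEps, sigPhi] at ih ⊢
        simp only [← ih.1, ← ih.2]
        grind

theorem bumpCol_listRaises {i x x' : ℕ} {C C' : List ℕ} (hC : C.Pairwise (· < ·))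
    (hC' : C'.Pairwise (· < ·)) (hl : C.length = C'.length)
    (h : ListRaises i (C ++ [x]) (C' ++ [x'])) :
    (bumpCol x C).1.isSome = (bumpCol x' C').1.isSome ∧
      ListRaises i ((bumpCol x C).1.toList ++ (bumpCol x C).2)
        ((bumpCol x' C').1.toList ++ (bumpCol x' C').2) := by
  induction C generalizing C' with
  | nil =>
    obtain rfl : C' = [] := by simpa using hl.symm
    simpa [bumpCol] using h
  | cons z C ih =>
    obtain ⟨z', C', rfl⟩ : ∃ z' D, C' = z' :: D := by
      cases C' with
      | nil => simp at hl
      | cons z' D => exact ⟨z', D, rfl⟩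
    have hl' : C.length = C'.length := by simpa using hl
    rw [List.pairwise_cons] at hC hC'
    rw [List.cons_append, List.cons_append, listRaises_cons_iff] at h
    rcases h with ⟨rfl, rfl, h, h0⟩ | ⟨rfl, h, h0⟩
    · obtain ⟨rfl, hx⟩ := List.append_inj h hl'
      obtain rfl : x = x' := by simpa using hx
      have hC0 : sigEps z' C = 0 := sigEps_eq_zero_of_forall_lt hC.1
      have hC1 : sigPhi z' C = 0 := sigPhi_eq_zero_of_forall_lt fun a ha => (hC'.1 a ha)
      have hx : x ≠ z' + 1 := by
        rintro rfl
        simp [sigEps_append, hC0, hC1, sigEps] at h0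
      by_cases hxz : x ≤ z'
      · have : x ≤ z' + 1 := by omega
        simp only [bumpCol, hxz, this, if_true, Option.toList_some, List.cons_append,
          List.nil_append, Option.isSome_some, true_and]
        rw [listRaises_cons_iff]
        refine Or.inl ⟨rfl, rfl, rfl, ?_⟩
        simp only [sigEps, hC0]
        split_ifs <;> omega
      · have : ¬ x ≤ z' + 1 := by omega
        simp only [bumpCol, hxz, this, if_false, true_and]
        have hD : sigEps z' (bumpCol x C).2 = 0 := sigEps_eq_zero_of_forall_lt fun a ha => by
          rcases mem_of_mem_bumpCol ha with rfl | ha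
          · omega
          · exact hC.1 a ha
        rw [listRaises_append_iff rfl]
        refine Or.inl ⟨rfl, ?_, ?_⟩
        · rw [listRaises_cons_iff]
          exact Or.inl ⟨rfl, rfl, rfl, hD⟩
        · have : sigPhi z' (bumpCol x C).1.toList = 0 := by
            refine sigPhi_eq_zero_of_forall_lt fun a ha => ?_
            have := bumpCol_eq_some (x := x) (C := C) (y := a) (by simpa using ha)
            omega
          simp [this, sigEps]
    · by_cases hx' : x' ≤ z
      · rw [listRaises_append_iff hl', listRaises_singleton_iff] at h
        rcases h with ⟨rfl, ⟨rfl, rfl⟩, hlt⟩ | ⟨hx, h, hle⟩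
        · by_cases hx : x' + 1 ≤ z
          · simp only [bumpCol, hx, hx', if_true, Option.toList_some, List.cons_append,
              List.nil_append, Option.isSome_some, true_and]
            have hC0 : sigEps x' C = 0 :=
              sigEps_eq_zero_of_forall_lt fun a ha => by have := hC.1 a ha; omega
            rw [listRaises_cons_iff, listRaises_cons_iff]
            refine Or.inr ⟨rfl, Or.inl ⟨rfl, rfl, rfl, hC0⟩, ?_⟩
            simp only [sigEps, hC0]
            grind
          · obtain rfl : z = x' := by omega
            cases C with
            | nil => simp [sigEps] at h0
            | cons r C =>
              have h3 : z < r := hC.1 r (by simp)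
              have h4 := (List.pairwise_cons.1 hC.2).1
              have hC0 : sigEps z C = 0 :=
                sigEps_eq_zero_of_forall_lt fun a ha => by have := h4 a ha; omega
              have hr : r = z + 1 := by
                by_contra hr
                simp only [List.cons_append, sigEps, sigEps_append, hC0] at h0
                grind
              subst hr
              simp only [bumpCol]
              simp [listRaises_cons_iff, sigEps, hC0]
        · obtain rfl : x = x' := by simpa using hx
          have hz := hC'.1 i h.mem_right
          have := h.sigEps_pos
          simp only [bumpCol, hx', if_true, Option.toList_some, List.cons_append,
              List.nil_append, Option.isSome_some, true_and]
          rw [listRaises_cons_iff, listRaises_cons_iff]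
          refine Or.inr ⟨rfl, Or.inr ⟨rfl, h, ?_⟩, ?_⟩
          · grind
          · simp only [sigEps]
            grind
      · have hxx : ¬ x ≤ z := by
          rw [listRaises_append_iff hl', listRaises_singleton_iff] at h
          rcases h with ⟨-, ⟨rfl, rfl⟩, -⟩ | ⟨hx, -⟩
          · omega
          · obtain rfl : x = x' := by simpa using hx
            exact hx'
        obtain ⟨ih1, ih2⟩ := ih hC.2 hC'.2 hl' h
        have hs := sig_bumpCol i x hC.2
        have hz : ∀ a ∈ (bumpCol x C).2, z < a := fun a ha => by
          rcases mem_of_mem_bumpCol ha with rfl | ha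
          · omega
          · exact hC.1 a ha
        have hz' : ∀ a ∈ (bumpCol x' C').2, z < a := fun a ha => by
          rcases mem_of_mem_bumpCol ha with rfl | ha
          · omega
          · exact hC'.1 a ha
        simp only [bumpCol, hxx, hx', if_false]
        refine ⟨ih1, ?_⟩
        rcases hb : (bumpCol x C).1 with _ | y <;> rcases hb' : (bumpCol x' C').1 with _ | y'
        · simp only [hb, hb', Option.toList_none, List.nil_append] at ih2 hs ⊢
          rw [listRaises_cons_iff]
          exact Or.inr ⟨rfl, ih2, hs.1 ▸ h0⟩
        · simp [hb, hb'] at ih1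
        · simp [hb, hb'] at ih1
        · simp only [hb, hb', Option.toList_some, List.cons_append, List.nil_append] at ih2 hs ⊢
          rw [listRaises_cons_iff] at ih2
          rcases ih2 with ⟨rfl, rfl, hD, hD0⟩ | ⟨rfl, hD, hD0⟩
          · rw [hD, listRaises_cons_iff]
            obtain ⟨-, -, d, D, hd, hdy⟩ := bumpCol_eq_some hb'
            have := hz' d (by simp [hd])
            refine Or.inl ⟨rfl, rfl, rfl, ?_⟩
            simp only [sigEps, ← hD, hD0]
            grind
          · have hzi := hz' i hD.mem_right
            rw [listRaises_cons_iff, listRaises_cons_iff]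
            refine Or.inr ⟨rfl, Or.inr ⟨rfl, hD, ?_⟩, ?_⟩
            · have := hD.sigEps_pos
              grind
            · simp only [sigEps]
              grind

/-! ### Column insertion commutes with raising -/

/-- The reading word of a tableau: columns from right to left, each read downwards. -/
def readCols : List (List ℕ) → List ℕ
  | [] => []
  | C :: R => readCols R ++ C

theorem insertTab_cons_of_eq_none {x : ℕ} {C : List ℕ} (R : List (List ℕ))
    (h : (bumpCol x C).1 = none) : insertTab (C :: R) x = (bumpCol x C).2 :: R := by
  rcases hb : bumpCol x C with ⟨_ | y, D⟩ <;> simp_all [insertTab]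

theorem insertTab_cons_of_eq_some {x y : ℕ} {C : List ℕ} (R : List (List ℕ))
    (h : (bumpCol x C).1 = some y) :
    insertTab (C :: R) x = (bumpCol x C).2 :: insertTab R y := by
  rcases hb : bumpCol x C with ⟨_ | y, D⟩ <;> simp_all [insertTab]

theorem insertTab_pairwise {T : List (List ℕ)} (hT : ∀ C ∈ T, C.Pairwise (· < ·)) (x : ℕ) :
    ∀ C ∈ insertTab T x, C.Pairwise (· < ·) := by
  induction T generalizing x with
  | nil => simp [insertTab]
  | cons C R ih =>
    rw [List.forall_mem_cons] at hT
    rcases hb : (bumpCol x C).1 with _ | y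
    · rw [insertTab_cons_of_eq_none R hb, List.forall_mem_cons]
      exact ⟨bumpCol_pairwise hT.1, hT.2⟩
    · rw [insertTab_cons_of_eq_some R hb, List.forall_mem_cons]
      exact ⟨bumpCol_pairwise hT.1, ih hT.2 y⟩

theorem sig_insertTab (i : ℕ) {T : List (List ℕ)} (hT : ∀ C ∈ T, C.Pairwise (· < ·)) (x : ℕ) :
    sigEps i (readCols (insertTab T x)) = sigEps i (readCols T ++ [x]) ∧
      sigPhi i (readCols (insertTab T x)) = sigPhi i (readCols T ++ [x]) := by
  induction T generalizing x with
  | nil => simp [insertTab, readCols]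
  | cons C R ih =>
    rw [List.forall_mem_cons] at hT
    have hs := sig_bumpCol i x hT.1
    rcases hb : (bumpCol x C).1 with _ | y
    · simp only [hb, Option.toList_none, List.nil_append] at hs
      rw [insertTab_cons_of_eq_none R hb]
      simp only [readCols, List.append_assoc]
      rw [sigEps_append, sigPhi_append, sigEps_append _ _ (C ++ [x]),
        sigPhi_append _ _ (C ++ [x]), hs.1, hs.2]
      exact ⟨rfl, rfl⟩
    · simp only [hb, Option.toList_some] at hs
      rw [insertTab_cons_of_eq_some R hb]
      simp only [readCols, List.append_assoc]
      rw [sigEps_append _ _ (C ++ [x]), sigPhi_append _ _ (C ++ [x]), ← hs.1, ← hs.2,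
        ← sigEps_append, ← sigPhi_append, ← List.append_assoc, sigEps_append, sigPhi_append,
        (ih hT.2 y).1, (ih hT.2 y).2, sigEps_append _ (_ ++ [y]), sigPhi_append _ (_ ++ [y])]
      exact ⟨rfl, rfl⟩

theorem readCols_length_eq {T T' : List (List ℕ)}
    (h : T.map List.length = T'.map List.length) :
    (readCols T).length = (readCols T').length := by
  induction T generalizing T' with
  | nil => simp_all
  | cons C R ih =>
    cases T' with
    | nil => simp at h
    | cons C' R' =>
      simp only [List.map_cons, List.cons.injEq] at h
      simp [readCols, h.1, ih h.2]

theorem readCols_injective {T T' : List (List ℕ)}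
    (h : T.map List.length = T'.map List.length) (hr : readCols T = readCols T') : T = T' := by
  induction T generalizing T' with
  | nil => simp_all
  | cons C R ih =>
    cases T' with
    | nil => simp at h
    | cons C' R' =>
      simp only [List.map_cons, List.cons.injEq] at h
      obtain ⟨h1, h2⟩ := List.append_inj hr (readCols_length_eq h.2)
      rw [h2, ih h.2 h1]

theorem ListRaises.append_congr {i : ℕ} {a a' u u' v v' : List ℕ}
    (ha : a.length = a'.length) (h : ListRaises i (a ++ u) (a' ++ u'))
    (he : sigEps i v = sigEps i u) (huv : ListRaises i u u' → ListRaises i v v')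
    (heq : u = u' → v = v') : ListRaises i (a ++ v) (a' ++ v') := by
  rw [listRaises_append_iff ha] at h ⊢
  rcases h with ⟨h1, h2, h3⟩ | ⟨h1, h2, h3⟩
  · exact Or.inl ⟨h1, huv h2, he ▸ h3⟩
  · exact Or.inr ⟨heq h1, h2, he ▸ h3⟩

theorem insertTab_listRaises {i x x' : ℕ} {T T' : List (List ℕ)}
    (hT : ∀ C ∈ T, C.Pairwise (· < ·)) (hT' : ∀ C ∈ T', C.Pairwise (· < ·))
    (hl : T.map List.length = T'.map List.length)
    (h : ListRaises i (readCols T ++ [x]) (readCols T' ++ [x'])) :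
    (insertTab T x).map List.length = (insertTab T' x').map List.length ∧
      ListRaises i (readCols (insertTab T x)) (readCols (insertTab T' x')) := by
  induction T generalizing T' x x' with
  | nil =>
    obtain rfl : T' = [] := by simpa using hl.symm
    simpa [insertTab, readCols] using h
  | cons C R ih =>
    obtain ⟨C', R', rfl⟩ : ∃ C' R', T' = C' :: R' := by
      cases T' with
      | nil => simp at hl
      | cons C' R' => exact ⟨C', R', rfl⟩
    rw [List.forall_mem_cons] at hT hT'
    simp only [List.map_cons, List.cons.injEq] at hl
    have hR := readCols_length_eq hl.2
    simp only [readCols, List.append_assoc] at h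
    have key : (bumpCol x C).1.isSome = (bumpCol x' C').1.isSome := by
      rcases (listRaises_append_iff hR).1 h with ⟨-, h, -⟩ | ⟨h, -⟩
      · exact (bumpCol_listRaises hT.1 hT'.1 hl.1 h).1
      · obtain ⟨rfl, h⟩ := List.append_inj h hl.1
        obtain rfl : x = x' := by simpa using h
        rfl
    have h' := h.append_congr hR (sig_bumpCol i x hT.1).1
      (fun h => (bumpCol_listRaises hT.1 hT'.1 hl.1 h).2)
      (fun h => by
        obtain ⟨rfl, h⟩ := List.append_inj h hl.1
        obtain rfl : x = x' := by simpa using h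
        rfl)
    have hlen := bumpCol_length x C
    have hlen' := bumpCol_length x' C'
    rcases hb : (bumpCol x C).1 with _ | y <;> rcases hb' : (bumpCol x' C').1 with _ | y'
    · rw [insertTab_cons_of_eq_none R hb, insertTab_cons_of_eq_none R' hb']
      simp only [hb, hb', Option.toList_none, List.nil_append, List.length_nil] at h' hlen hlen'
      refine ⟨?_, h'⟩
      simp only [List.map_cons, hl.2, List.cons.injEq, and_true]
      omega
    · simp [hb, hb'] at key
    · simp [hb, hb'] at key
    · rw [insertTab_cons_of_eq_some R hb, insertTab_cons_of_eq_some R' hb']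
      simp only [hb, hb', Option.toList_some, List.length_singleton] at h' hlen hlen'
      rw [← List.append_assoc, ← List.append_assoc,
        listRaises_append_iff (by simpa using hR)] at h'
      simp only [List.map_cons, List.cons.injEq, readCols]
      have hD : (bumpCol x C).2.length = (bumpCol x' C').2.length := by omega
      rcases h' with ⟨h1, h2, h3⟩ | ⟨h1, h2, h3⟩
      · obtain ⟨h4, h5⟩ := List.append_inj h1 hR
        obtain rfl : y = y' := by simpa using h5
        obtain rfl := readCols_injective hl.2 h4
        refine ⟨⟨hD, rfl⟩, ?_⟩
        rw [listRaises_append_iff rfl]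
        exact Or.inl ⟨rfl, h2, (sig_insertTab i hT.2 y).2 ▸ h3⟩
      · obtain ⟨h4, h5⟩ := ih hT.2 hT'.2 hl.2 h2
        refine ⟨⟨hD, h4⟩, ?_⟩
        rw [listRaises_append_iff (readCols_length_eq h4)]
        exact Or.inr ⟨h1, h5, (sig_insertTab i hT.2 y).2 ▸ h3⟩

/-! ### The recording tableau is invariant under raising -/

theorem growQ_congr {p p' r r' : List (List ℕ)} (hp : p.map List.length = p'.map List.length)
    (hr : r.map List.length = r'.map List.length) (q : List (List ℕ)) (t : ℕ) :
    growQ p r q t = growQ p' r' q t := by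
  induction p generalizing p' r r' q with
  | nil =>
    obtain rfl : p' = [] := by simpa using hp.symm
    simp [growQ]
  | cons c p ih =>
    cases p' with
    | nil => simp at hp
    | cons c' p' =>
      cases r with
      | nil =>
        obtain rfl : r' = [] := by simpa using hr.symm
        simp [growQ]
      | cons d r =>
        cases r' with
        | nil => simp at hr
        | cons d' r' =>
          cases q with
          | nil => simp [growQ]
          | cons e q =>
            simp only [List.map_cons, List.cons.injEq] at hp hr
            simp only [growQ, hp.1, hr.1, ih hp.2 hr.2]

theorem rsk_concat (bw : List (ℕ × ℕ)) (tx : ℕ × ℕ) :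
    rsk (bw ++ [tx]) = rskStep (rsk bw) tx := by
  simp [rsk]

theorem rsk_fst_pairwise (bw : List (ℕ × ℕ)) : ∀ C ∈ (rsk bw).1, C.Pairwise (· < ·) := by
  induction bw using List.reverseRecOn with
  | nil => simp [rsk]
  | append_singleton bw tx ih =>
    rw [rsk_concat]
    exact insertTab_pairwise ih _

theorem sig_rsk (i : ℕ) (bw : List (ℕ × ℕ)) :
    sigEps i (readCols (rsk bw).1) = sigEps i (bw.map Prod.snd) ∧
      sigPhi i (readCols (rsk bw).1) = sigPhi i (bw.map Prod.snd) := by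
  induction bw using List.reverseRecOn with
  | nil => simp [rsk, readCols]
  | append_singleton bw tx ih =>
    rw [rsk_concat]
    simp only [rskStep, sig_insertTab i (rsk_fst_pairwise bw), sigEps_append, sigPhi_append, ih,
      List.map_append, List.map_cons, List.map_nil, and_self]

theorem rsk_listRaises {i : ℕ} {bw bw' : List (ℕ × ℕ)}
    (ht : bw.map Prod.fst = bw'.map Prod.fst)
    (h : ListRaises i (bw.map Prod.snd) (bw'.map Prod.snd)) :
    (rsk bw).1.map List.length = (rsk bw').1.map List.length ∧
      ListRaises i (readCols (rsk bw).1) (readCols (rsk bw').1) ∧ (rsk bw).2 = (rsk bw').2 := by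
  induction bw using List.reverseRecOn generalizing bw' with
  | nil => exact absurd h not_listRaises_nil
  | append_singleton bw tx ih =>
    rcases List.eq_nil_or_concat bw' with rfl | ⟨bw', tx', rfl⟩
    · simp at ht
    have hl : bw.length = bw'.length := by
      have := congrArg List.length ht
      simpa using this
    simp only [List.concat_eq_append, List.map_append, List.map_cons, List.map_nil] at hl ht h ⊢
    obtain ⟨ht, htx⟩ := List.append_inj ht (by simpa using hl)
    replace htx : tx.1 = tx'.1 := by simpa using htx
    have hs := sig_rsk i bw
    have key : (rsk bw).1.map List.length = (rsk bw').1.map List.length ∧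
        ListRaises i (readCols (rsk bw).1 ++ [tx.2]) (readCols (rsk bw').1 ++ [tx'.2]) ∧
          (rsk bw).2 = (rsk bw').2 := by
      rcases (listRaises_append_iff (by simpa using hl)).1 h with ⟨h1, h2, h3⟩ | ⟨h1, h2, h3⟩
      · obtain rfl : bw = bw' := by
          rw [← List.zip_unzip bw, ← List.zip_unzip bw', List.unzip_eq_map, List.unzip_eq_map,
            ht, h1]
        exact ⟨rfl, (listRaises_append_iff rfl).2 (Or.inl ⟨rfl, h2, hs.2 ▸ h3⟩), rfl⟩
      · obtain ⟨h4, h5, h6⟩ := ih ht h2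
        exact ⟨h4, (listRaises_append_iff (readCols_length_eq h4)).2
          (Or.inr ⟨h1, h5, hs.2 ▸ h3⟩), h6⟩
    obtain ⟨h4, h5, h6⟩ := key
    obtain ⟨h7, h8⟩ := insertTab_listRaises (rsk_fst_pairwise bw) (rsk_fst_pairwise bw') h4 h5
    simp only [rsk_concat, rskStep]
    refine ⟨h7, h8, ?_⟩
    rw [h6, htx, growQ_congr h4 h7]

/-! ### Raising operators on functions and on lists -/

/-- The number of letters `i + 1` minus the number of letters `i` among the first `l` letters. -/
def excess (i : ℕ) (w : ℕ → ℕ) (l : ℕ) : ℤ :=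
  ∑ s ∈ Finset.Icc 1 l, (epsL i (w s) - phiL i (w s))

theorem excess_zero (i : ℕ) (w : ℕ → ℕ) : excess i w 0 = 0 := by simp [excess]

theorem excess_succ (i : ℕ) (w : ℕ → ℕ) (l : ℕ) :
    excess i w (l + 1) = excess i w l + epsL i (w (l + 1)) - phiL i (w (l + 1)) := by
  rw [excess, Finset.sum_Icc_succ_top (by omega), excess]
  ring

theorem ce_succ (i : ℕ) (w : ℕ → ℕ) (j : ℕ) :
    ce w i (j + 1) = excess i w j + epsL i (w (j + 1)) := by
  rw [ce, Finset.sum_Icc_succ_top (by omega), excess, Finset.sum_sub_distrib, Nat.add_sub_cancel]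
  ring

theorem epsL_nonneg (i s : ℕ) : 0 ≤ epsL i s := by
  unfold epsL
  split_ifs <;> omega

theorem phiL_nonneg (i s : ℕ) : 0 ≤ phiL i s := by
  unfold phiL
  split_ifs <;> omega

theorem excess_eq_sig (i : ℕ) (w : ℕ → ℕ) (c l : ℕ) :
    excess i w (c + l) - excess i w c =
      sigEps i ((List.range' (c + 1) l).map w) - sigPhi i ((List.range' (c + 1) l).map w) := by
  induction l generalizing c with
  | zero => simp [sigEps, sigPhi]
  | succ l ih =>
    have := ih (c + 1)
    rw [excess_succ, show c + 1 + l = c + (l + 1) by omega] at this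
    simp only [List.range'_succ, List.map_cons, sigEps, sigPhi]
    unfold epsL phiL at this
    grind

theorem sigPhi_range'_eq_zero {i c l : ℕ} {w : ℕ → ℕ}
    (h : ∀ b, c ≤ b → b ≤ c + l → excess i w b ≤ excess i w (c + l)) :
    sigPhi i ((List.range' (c + 1) l).map w) = 0 := by
  induction l generalizing c with
  | zero => simp [sigPhi]
  | succ l ih =>
    have h1 := ih (c := c + 1) fun b hb hb' => by
      rw [show c + 1 + l = c + (l + 1) by omega]
      exact h b (by omega) (by omega)
    have h2 := excess_eq_sig i w c (l + 1)
    have h3 := h c le_rfl (by omega)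
    simp only [List.range'_succ, List.map_cons, sigEps, sigPhi, h1] at h2 ⊢
    grind

theorem sigEps_range'_eq_zero {i c l : ℕ} {w : ℕ → ℕ}
    (h : ∀ b, c ≤ b → b ≤ c + l → excess i w b ≤ excess i w c) :
    sigEps i ((List.range' (c + 1) l).map w) = 0 := by
  induction l with
  | zero => simp [sigEps]
  | succ l ih =>
    have h1 := ih fun b hb hb' => h b hb (by omega)
    have h2 := excess_eq_sig i w c (l + 1)
    have h3 := h (c + (l + 1)) (by omega) le_rfl
    simp only [List.range'_concat, one_mul, List.map_append, List.map_cons, List.map_nil,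
      sigEps_append, sigPhi_append, h1, sigEps, sigPhi] at h2 ⊢
    grind

theorem Raises.exists_excess_le {k i : ℕ} {w w' : ℕ → ℕ} (h : Raises k i w w') :
    ∃ j, j + 1 ≤ k ∧ w (j + 1) = i + 1 ∧ w' = Function.update w (j + 1) i ∧
      (∀ l ≤ j, excess i w l ≤ excess i w j) ∧
      ∀ l, j + 1 ≤ l → l ≤ k → excess i w l ≤ excess i w (j + 1) := by
  obtain ⟨E, j, ⟨-, hE⟩, hj, hjE, hmin, hwj, rfl⟩ := h
  simp only [Finset.mem_Icc] at hE hj hmin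
  obtain ⟨j, rfl⟩ : ∃ j', j = j' + 1 := ⟨j - 1, by omega⟩
  have h1 : ∀ l, l + 1 ≤ k → excess i w (l + 1) ≤ ce w i (l + 1) := fun l _ => by
    rw [ce_succ, excess_succ]
    linarith [phiL_nonneg i (w (l + 1))]
  have h2 : ce w i (j + 1) = excess i w j + 1 := by simp [ce_succ, epsL, hwj]
  have h3 : excess i w (j + 1) = excess i w j + 1 := by
    simp [excess_succ, epsL, phiL, hwj]
  have h4 : ∀ l, l + 1 ≤ j → ce w i (l + 1) ≤ excess i w j := fun l hl => by
    have h5 := hE (l + 1) (by omega)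
    have h6 : ce w i (l + 1) ≠ E := fun h => by
      have := hmin (l + 1) (by omega) h
      omega
    omega
  refine ⟨j, hj.2, hwj, rfl, fun l hl => ?_, fun l hl hlk => ?_⟩
  · rcases l with _ | l
    · rcases j with _ | j
      · exact le_rfl
      · have h5 := h4 0 (by omega)
        rw [ce_succ] at h5
        linarith [epsL_nonneg i (w (0 + 1))]
    · exact (h1 l (by omega)).trans (h4 l hl)
  · obtain ⟨l, rfl⟩ : ∃ l', l = l' + 1 := ⟨l - 1, by omega⟩
    have h5 := h1 l hlk
    have h6 := hE (l + 1) (by omega)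
    omega

theorem exists_raises_of_excess_pos {k i l : ℕ} {w : ℕ → ℕ} (hl : l ≤ k)
    (hpos : 0 < excess i w l) : ∃ w', Raises k i w w' := by
  have hl0 : l ≠ 0 := by
    rintro rfl
    simp [excess_zero] at hpos
  obtain ⟨l, rfl⟩ : ∃ l', l = l' + 1 := ⟨l - 1, by omega⟩
  obtain ⟨a, ha, hmax⟩ := Finset.exists_max_image (Finset.Icc 1 k) (ce w i)
    ⟨l + 1, Finset.mem_Icc.2 ⟨by omega, hl⟩⟩
  classical
  have hex : ∃ j, j ∈ Finset.Icc 1 k ∧ ce w i j = ce w i a := ⟨a, ha, rfl⟩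
  obtain ⟨hj, hja⟩ := Nat.find_spec hex
  have hmin : ∀ j ∈ Finset.Icc 1 k, ce w i j = ce w i a → Nat.find hex ≤ j :=
    fun j h1 h2 => Nat.find_min' hex ⟨h1, h2⟩
  generalize Nat.find hex = j at hj hja hmin
  refine ⟨_, ce w i a, j, ⟨⟨a, ha, rfl⟩, hmax⟩, hj, hja, hmin, ?_, rfl⟩
  simp only [Finset.mem_Icc] at hj hmin hmax
  obtain ⟨j, rfl⟩ : ∃ j', j = j' + 1 := ⟨j - 1, by omega⟩
  have h1 := hmax (l + 1) (by omega)
  rw [ce_succ] at h1 hja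
  rw [excess_succ] at hpos
  have h2 := phiL_nonneg i (w (l + 1))
  by_contra hw
  have h3 : epsL i (w (j + 1)) = 0 := by simp [epsL, hw]
  rcases j with _ | j
  · rw [excess_zero] at hja
    omega
  · have h4 := hmax (j + 1) (by omega)
    have h5 := fun h => hmin (j + 1) (by omega) h
    rw [excess_succ] at hja
    rw [ce_succ] at h4 h5
    have h6 := phiL_nonneg i (w (j + 1))
    have := h5 (by omega)
    omega

theorem bwList_eq (k : ℕ) (τ w : ℕ → ℕ) :
    bwList k τ w = (List.range' 1 k).map fun s => (τ s, w s) := by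
  rw [List.range'_eq_map_range, List.map_map, bwList]
  exact List.map_congr_left fun j _ => by simp [Nat.add_comm]

theorem Raises.listRaises {k i : ℕ} {w w' : ℕ → ℕ} (h : Raises k i w w') :
    ListRaises i ((List.range' 1 k).map w) ((List.range' 1 k).map w') := by
  obtain ⟨j, hj, hwj, rfl, h1, h2⟩ := h.exists_excess_le
  obtain ⟨d, rfl⟩ := Nat.exists_eq_add_of_le hj
  have hsplit : List.range' 1 (j + 1 + d) =
      List.range' (0 + 1) j ++ (j + 1) :: List.range' (j + 1 + 1) d := by
    rw [Nat.add_assoc, ← List.range'_append_1, Nat.add_comm 1 d, List.range'_succ,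
      Nat.add_comm 1 j]
  refine ⟨(List.range' (0 + 1) j).map w, (List.range' (j + 1 + 1) d).map w, ?_, ?_, ?_, ?_⟩
  · rw [hsplit, List.map_append, List.map_cons, hwj]
  · rw [hsplit, List.map_append, List.map_cons, Function.update_self]
    congr 1
    · refine List.map_congr_left fun s hs => Function.update_of_ne ?_ _ _
      simp only [List.mem_range'_1] at hs
      omega
    · congr 1
      refine List.map_congr_left fun s hs => Function.update_of_ne ?_ _ _
      simp only [List.mem_range'_1] at hs
      omega
  · refine sigPhi_range'_eq_zero fun b _ hb => ?_
    rw [Nat.zero_add] at hb ⊢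
    exact h1 b hb
  · exact sigEps_range'_eq_zero fun b hb hb' => h2 b hb hb'

theorem Raises.rsk_snd_eq {k i : ℕ} {w w' : ℕ → ℕ} (h : Raises k i w w') (τ : ℕ → ℕ) :
    (rsk (bwList k τ w)).2 = (rsk (bwList k τ w')).2 := by
  refine (rsk_listRaises (i := i) ?_ ?_).2.2
  · simp [bwList]
  · simpa [bwList_eq, Function.comp_def] using h.listRaises

theorem Raises.stdForm {k i : ℕ} {τ w w' : ℕ → ℕ} (h : Raises k i w w')
    (hw : StdForm k τ w) : StdForm k τ w' := by
  obtain ⟨j, hj, hwj, rfl, -, h2⟩ := h.exists_excess_le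
  refine ⟨hw.1, fun s hs hsk hτ => ?_⟩
  have h3 := hw.2 s hs hsk hτ
  simp only [Function.update_apply]
  split_ifs with h4 h5 h5
  · omega
  · obtain rfl : s = j := by omega
    omega
  · subst h5
    have h6 : w (j + 1 + 1) ≠ i + 1 := fun h6 => by
      have h7 := h2 (j + 1 + 1) (by omega) hsk
      rw [excess_succ _ _ (j + 1)] at h7
      simp [epsL, phiL, h6] at h7
    omega
  · exact h3

theorem exists_highestOf {n k : ℕ} {τ w : ℕ → ℕ} (hw : IsWord n k w) (hstd : StdForm k τ w) :
    ∃ v, HighestOf n k w v ∧ IsWord n k v ∧ StdForm k τ v ∧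
      (rsk (bwList k τ v)).2 = (rsk (bwList k τ w)).2 ∧ ∀ s ∉ Finset.Icc 1 k, v s = w s := by
  induction hN : ∑ s ∈ Finset.Icc 1 k, w s using Nat.strong_induction_on generalizing w with
  | _ N ih =>
  by_cases hex : ∃ i, 1 ≤ i ∧ i < n ∧ ∃ w', Raises k i w w'
  · obtain ⟨i, hi, hin, w', h⟩ := hex
    have hs := h.stdForm hstd
    have hq := h.rsk_snd_eq τ
    have hstep : RaiseStep n k w w' := ⟨i, hi, hin, h⟩
    obtain ⟨j, hj, hwj, rfl, -⟩ := h.exists_excess_le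
    have hjm : j + 1 ∈ Finset.Icc 1 k := Finset.mem_Icc.2 ⟨by omega, hj⟩
    have hw' : IsWord n k (Function.update w (j + 1) i) := fun s hsk => by
      rw [Function.update_apply]
      split_ifs
      · exact Finset.mem_Icc.2 ⟨hi, hin.le⟩
      · exact hw s hsk
    have hlt : ∑ s ∈ Finset.Icc 1 k, Function.update w (j + 1) i s < N := by
      rw [← hN]
      refine Finset.sum_lt_sum (fun s _ => ?_) ⟨j + 1, hjm, by simp [hwj]⟩
      rw [Function.update_apply]
      split_ifs with hsj
      · rw [hsj]
        omega
      · exact le_rfl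
    obtain ⟨v, hv, hv1, hv2, hv3, hv4⟩ := ih _ hlt hw' hs rfl
    refine ⟨v, ⟨hv.1.head hstep, hv.2⟩, hv1, hv2, hv3.trans hq.symm, fun s hsk => ?_⟩
    rw [hv4 s hsk, Function.update_of_ne]
    rintro rfl
    exact hsk hjm
  · exact ⟨w, ⟨.refl, fun i hi hin h => hex ⟨i, hi, hin, h⟩⟩, hw, hstd, rfl, fun _ _ => rfl⟩

/-! ### Insertion of highest weight words -/

/-- Add a box in row `r` to the sequence `L` of column lengths of a Young diagram. -/
def addBox (r : ℕ) : List ℕ → List ℕ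
  | [] => [r]
  | l :: L => if r ≤ l then l :: addBox r L else r :: L

theorem bumpCol_range' (a d l : ℕ) (h : d ≤ l) :
    bumpCol (a + d) (List.range' a l) =
      if d < l then (some (a + d), List.range' a l) else (none, List.range' a (l + 1)) := by
  induction l generalizing a d with
  | zero =>
    obtain rfl : d = 0 := by omega
    simp [bumpCol]
  | succ l ih =>
    rw [List.range'_succ, bumpCol]
    rcases d with _ | d
    · simp
    · have := ih (a + 1) d (by omega)
      rw [show a + 1 + d = a + (d + 1) by omega] at this
      simp only [this, show ¬ a + (d + 1) ≤ a by omega, if_false, Nat.add_lt_add_iff_right]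
      split_ifs
      · rfl
      · rw [List.range'_succ (s := a) (n := l + 1)]

theorem countP_le_eq_zero {r l : ℕ} {L : List ℕ} (h : ∀ a ∈ L, a ≤ l) (hr : l < r) :
    L.countP (r ≤ ·) = 0 := by
  simp only [List.countP_eq_zero, decide_eq_true_eq]
  intro a ha
  have := h a ha
  omega

theorem eq_of_addable {r l : ℕ} {L : List ℕ} (hL : (l :: L).Pairwise (· ≥ ·))
    (hr : r = 0 ∨ (l :: L).countP (r + 1 ≤ ·) < (l :: L).countP (r ≤ ·)) (hlr : ¬ r + 1 ≤ l) :
    l = r := by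
  rcases hr with rfl | hr
  · omega
  · by_contra hne
    rw [List.pairwise_cons] at hL
    rw [countP_le_eq_zero (l := l) (r := r) (by simpa using hL.1) (by omega)] at hr
    omega

theorem addable_tail {r l : ℕ} {L : List ℕ}
    (hr : r = 0 ∨ (l :: L).countP (r + 1 ≤ ·) < (l :: L).countP (r ≤ ·)) (hlr : r + 1 ≤ l) :
    r = 0 ∨ L.countP (r + 1 ≤ ·) < L.countP (r ≤ ·) := by
  refine hr.imp_right fun h => ?_
  have : r ≤ l := by omega
  simp only [List.countP_cons, hlr, this, decide_true, if_true] at h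
  omega

theorem insertTab_map_range' {r : ℕ} {L : List ℕ} (hL : L.Pairwise (· ≥ ·))
    (hr : r = 0 ∨ L.countP (r + 1 ≤ ·) < L.countP (r ≤ ·)) :
    insertTab (L.map (List.range' 1)) (r + 1) = (addBox (r + 1) L).map (List.range' 1) := by
  induction L with
  | nil =>
    obtain rfl : r = 0 := by simpa using hr
    rfl
  | cons l L ih =>
    by_cases hlr : r + 1 ≤ l
    · have hb := bumpCol_range' 1 r l (by omega)
      rw [if_pos (by omega), Nat.add_comm] at hb
      rw [List.map_cons, insertTab_cons_of_eq_some (y := r + 1) _ (by rw [hb]), hb,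
        ih hL.of_cons (addable_tail hr hlr), addBox, if_pos hlr, List.map_cons]
    · obtain rfl := eq_of_addable hL hr hlr
      have hb := bumpCol_range' 1 l l le_rfl
      rw [if_neg (by omega), Nat.add_comm] at hb
      rw [List.map_cons, insertTab_cons_of_eq_none _ (by rw [hb]), hb, addBox, if_neg hlr,
        List.map_cons, Nat.add_comm]

theorem countP_addBox {r : ℕ} {L : List ℕ} (hL : L.Pairwise (· ≥ ·))
    (hr : r = 0 ∨ L.countP (r + 1 ≤ ·) < L.countP (r ≤ ·)) (s : ℕ) :
    (addBox (r + 1) L).countP (s + 1 ≤ ·) = L.countP (s + 1 ≤ ·) + if s = r then 1 else 0 := by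
  induction L with
  | nil =>
    obtain rfl : r = 0 := by simpa using hr
    simp [addBox, List.countP_cons]
  | cons l L ih =>
    by_cases hlr : r + 1 ≤ l
    · rw [addBox, if_pos hlr, List.countP_cons, List.countP_cons,
        ih hL.of_cons (addable_tail hr hlr)]
      omega
    · obtain rfl := eq_of_addable hL hr hlr
      rw [addBox, if_neg hlr, List.countP_cons, List.countP_cons]
      simp only [decide_eq_true_eq]
      split_ifs <;> omega

theorem mem_addBox {a r : ℕ} {L : List ℕ} (h : a ∈ addBox r L) : a = r ∨ a ∈ L := by
  induction L with
  | nil => simpa [addBox] using h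
  | cons l L ih => grind [addBox]

theorem addBox_pairwise {r : ℕ} {L : List ℕ} (hL : L.Pairwise (· ≥ ·)) :
    (addBox r L).Pairwise (· ≥ ·) := by
  induction L with
  | nil => simp [addBox]
  | cons l L ih =>
    have hL' := List.pairwise_cons.1 hL
    by_cases hlr : r ≤ l
    · rw [addBox, if_pos hlr, List.pairwise_cons]
      refine ⟨fun a ha => ?_, ih hL'.2⟩
      rcases mem_addBox ha with rfl | ha
      · exact hlr
      · exact hL'.1 a ha
    · rw [addBox, if_neg hlr, List.pairwise_cons]
      refine ⟨fun a ha => ?_, hL'.2⟩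
      have := hL'.1 a ha
      omega

theorem growQ_addBox {r : ℕ} {L : List ℕ} (hL : L.Pairwise (· ≥ ·))
    (hr : r = 0 ∨ L.countP (r + 1 ≤ ·) < L.countP (r ≤ ·)) {q : List (List ℕ)}
    (hq : q.map List.length = L) (t : ℕ) :
    (growQ (L.map (List.range' 1)) ((addBox (r + 1) L).map (List.range' 1)) q t).map List.length =
        addBox (r + 1) L ∧
      ∀ a s, (growQ (L.map (List.range' 1)) ((addBox (r + 1) L).map (List.range' 1)) q t).countP
          (fun C => C[s]? = some a) =
        q.countP (fun C => C[s]? = some a) + if t = a ∧ r = s then 1 else 0 := by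
  induction L generalizing q with
  | nil =>
    obtain rfl : r = 0 := by simpa using hr
    obtain rfl : q = [] := by simpa using hq
    refine ⟨rfl, fun a s => ?_⟩
    rcases s with _ | s <;> simp [growQ, List.countP_cons]
  | cons l L ih =>
    obtain ⟨c, q, rfl⟩ : ∃ c q', q = c :: q' := by
      cases q with
      | nil => simp at hq
      | cons c q' => exact ⟨c, q', rfl⟩
    simp only [List.map_cons, List.cons.injEq] at hq
    obtain ⟨hc, hq⟩ := hq
    by_cases hlr : r + 1 ≤ l
    · obtain ⟨h1, h2⟩ := ih hL.of_cons (addable_tail hr hlr) hq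
      simp only [addBox, if_pos hlr, List.map_cons, growQ, lt_irrefl, if_false, h1, hc,
        List.countP_cons, h2, true_and]
      intro a s
      omega
    · obtain rfl := eq_of_addable hL hr hlr
      simp only [addBox, if_neg hlr, List.map_cons, growQ, List.length_range', Nat.lt_add_one,
        if_true, List.length_append, List.length_singleton, hc, hq, List.countP_cons, true_and]
      intro a s
      rw [Nat.add_assoc]
      congr 1
      rcases lt_trichotomy s l with hs | rfl | hs
      · rw [List.getElem?_append_left (by omega)]
        simp [hs.ne']
      · subst hc
        simp
      · rw [List.getElem?_eq_none (by simp; omega), List.getElem?_eq_none (by omega)]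
        simp [hs.ne]

theorem excess_eq_count (i : ℕ) (w : ℕ → ℕ) (l : ℕ) :
    excess i w l = (((List.range' 1 l).map w).count (i + 1) : ℤ) -
      ((List.range' 1 l).map w).count i := by
  induction l with
  | zero => simp [excess_zero]
  | succ l ih =>
    rw [excess_succ, ih, List.range'_concat, epsL, phiL]
    simp only [one_mul, Nat.add_comm 1 l, List.map_append, List.map_cons, List.map_nil,
      List.count_append, List.count_singleton, beq_iff_eq, Nat.cast_add, Nat.cast_ite,
      Nat.cast_one, Nat.cast_zero]
    ring

theorem rsk_of_excess_nonpos {n k : ℕ} {τ v : ℕ → ℕ} (hv : IsWord n k v)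
    (hex : ∀ i, 1 ≤ i → i < n → ∀ l ≤ k, excess i v l ≤ 0) :
    ∃ L : List ℕ, L.Pairwise (· ≥ ·) ∧ (rsk (bwList k τ v)).1 = L.map (List.range' 1) ∧
      (rsk (bwList k τ v)).2.map List.length = L ∧
      (∀ s, L.countP (s + 1 ≤ ·) = ((List.range' 1 k).map v).count (s + 1)) ∧
      ∀ a s, (rsk (bwList k τ v)).2.countP (fun C => C[s]? = some a) =
        (bwList k τ v).count (a, s + 1) := by
  induction k with
  | zero => exact ⟨[], by simp [bwList, rsk]⟩
  | succ k ih =>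
    obtain ⟨L, hL, hP, hQ, hcnt, hQc⟩ := ih
      (fun s hs => hv s (by simp only [Finset.mem_Icc] at hs ⊢; omega))
      (fun i hi hin l hl => hex i hi hin l (by omega))
    have hvk := Finset.mem_Icc.1 (hv (k + 1) (by simp))
    obtain ⟨r, hr⟩ : ∃ r, v (k + 1) = r + 1 := ⟨v (k + 1) - 1, by omega⟩
    have hadd : r = 0 ∨ L.countP (r + 1 ≤ ·) < L.countP (r ≤ ·) := by
      rcases r with _ | r
      · exact Or.inl rfl
      · right
        rw [hcnt, hcnt]
        have h1 := hex (r + 1) (by omega) (by omega) (k + 1) le_rfl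
        rw [excess_succ, excess_eq_count, hr] at h1
        simp [epsL, phiL] at h1
        omega
    have hbw : bwList (k + 1) τ v = bwList k τ v ++ [(τ (k + 1), r + 1)] := by
      rw [bwList, List.range_succ, List.map_append, ← bwList, List.map_singleton, hr]
    obtain ⟨h1, h2⟩ := growQ_addBox hL hadd hQ (τ (k + 1))
    refine ⟨addBox (r + 1) L, addBox_pairwise hL, ?_, ?_, fun s => ?_, fun a s => ?_⟩
    · rw [hbw, rsk_concat, rskStep, hP]
      exact insertTab_map_range' hL hadd
    · rw [hbw, rsk_concat, rskStep, hP]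
      simp only
      rw [insertTab_map_range' hL hadd, h1]
    · rw [countP_addBox hL hadd, hcnt, List.range'_concat]
      simp only [one_mul, Nat.add_comm 1 k, List.map_append, List.map_cons, List.map_nil,
        List.count_append, List.count_singleton, beq_iff_eq, hr, Nat.add_right_cancel_iff,
        eq_comm (a := s)]
    · rw [hbw, rsk_concat, rskStep, hP]
      simp only
      rw [insertTab_map_range' hL hadd, h2, hQc, List.count_append, List.count_singleton]
      simp

/-! ### Counting and uniqueness of the standard form -/

theorem card_filter_Icc_one (k : ℕ) (p : ℕ → Prop) [DecidablePred p] :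
    ((Finset.Icc 1 k).filter p).card = (List.range' 1 k).countP p := by
  rw [List.countP_eq_length_filter]
  rfl

theorem countPairs_eq_count (k : ℕ) (τ w : ℕ → ℕ) (a r : ℕ) :
    countPairs k τ w a r = (bwList k τ w).count (a, r) := by
  rw [countPairs, card_filter_Icc_one, bwList_eq, List.count, List.countP_map]
  refine List.countP_congr fun s _ => ?_
  simp

theorem cnt_tabEntry (Q : List (List ℕ)) (a s : ℕ) :
    cnt Q.length (tabEntry Q) a (s + 1) = Q.countP (fun C => C[s]? = some a) := by
  have hQ : (List.range' 1 Q.length).map (fun c => Q.getD (c - 1) []) = Q := by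
    refine List.ext_getElem (by simp) fun j h1 h2 => ?_
    simp [h2]
  rw [cnt, card_filter_Icc_one]
  conv_rhs => rw [← hQ, List.countP_map]
  refine List.countP_congr fun c hc => ?_
  have : 1 ≤ c := (List.mem_range'_1.1 hc).1
  simp [tabEntry, this]

theorem countPairs_zero_right {n k : ℕ} {τ w : ℕ → ℕ} (hw : IsWord n k w) (a : ℕ) :
    countPairs k τ w a 0 = 0 := by
  rw [countPairs, Finset.card_eq_zero, Finset.filter_eq_empty_iff]
  rintro s hs ⟨-, h⟩
  have := Finset.mem_Icc.1 (hw s hs)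
  omega

/-- The weak order on the columns of biwords with respect to which the biwords in standard form
are the sorted ones. -/
def ColumnLE (x y : ℕ × ℕ) : Prop := x.1 < y.1 ∨ x.1 = y.1 ∧ y.2 ≤ x.2

theorem StdForm.pairwise_columnLE {k : ℕ} {τ w : ℕ → ℕ} (h : StdForm k τ w) :
    (bwList k τ w).Pairwise ColumnLE := by
  have : IsTrans (ℕ × ℕ) ColumnLE := ⟨fun a b c hab hbc => by
    unfold ColumnLE at *
    omega⟩
  rw [← List.isChain_iff_pairwise, List.isChain_iff_getElem]
  intro j hj
  have hjk : j + 1 < k := by simpa [bwList] using hj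
  have h1 := h.1 (j + 1) (by omega) hjk
  have h2 := h.2 (j + 1) (by omega) hjk
  simp only [bwList, List.getElem_map, List.getElem_range, ColumnLE]
  omega

theorem StdForm.eq_of_countPairs_eq {k : ℕ} {τ w w' : ℕ → ℕ} (h : StdForm k τ w)
    (h' : StdForm k τ w') (hc : ∀ a r, countPairs k τ w a r = countPairs k τ w' a r)
    {s : ℕ} (hs : s ∈ Finset.Icc 1 k) : w s = w' s := by
  have hperm : (bwList k τ w).Perm (bwList k τ w') := by
    rw [List.perm_iff_count]
    rintro ⟨a, r⟩
    rw [← countPairs_eq_count, ← countPairs_eq_count, hc]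
  have heq := hperm.eq_of_pairwise (le := ColumnLE) (fun a b _ _ hab hba => by
    unfold ColumnLE at *
    ext <;> omega) h.pairwise_columnLE h'.pairwise_columnLE
  rw [bwList_eq, bwList_eq, List.map_inj_left] at heq
  have := heq s (by rw [List.mem_range'_1]; rw [Finset.mem_Icc] at hs; omega)
  simpa using this

theorem HighestOf.countPairs_eq_cnt {n k : ℕ} {τ w v : ℕ → ℕ} (hv : HighestOf n k w v)
    (hvw : IsWord n k v) (a r : ℕ) :
    countPairs k τ v a r =
      cnt (rsk (bwList k τ v)).2.length (tabEntry (rsk (bwList k τ v)).2) a r := by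
  rcases r with _ | r
  · rw [countPairs_zero_right hvw]
    simp [cnt, tabEntry]
  · obtain ⟨L, -, -, -, -, h⟩ := rsk_of_excess_nonpos (τ := τ) hvw fun i hi hin l hl =>
      not_lt.1 fun hpos => hv.2 i hi hin (exists_raises_of_excess_pos hl hpos)
    rw [cnt_tabEntry, h, countPairs_eq_count]

/-- let `(τ, ω)` be a standard-form biword with `RSK(τ,ω) = (P, Q)`, and
let `η` be the word listing, for each value `t = 1, 2, …` in increasing order, the row
indices of the boxes of `Q` filled with `t`, in weakly decreasing order (equivalently:
`(τ, η)` is a standard-form biword whose column multiplicities match the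
(value, row) multiplicities of `Q`).  Then `η` is the highest weight of the connected
crystal component containing `ω`. -/
theorem stmt15 (n m k : ℕ) (hn : 2 ≤ n) (hm : 1 ≤ m) (hk : 1 ≤ k)
    (τ ω η : ℕ → ℕ) (hτ : IsWord m k τ) (hω : IsWord n k ω) (hstd : StdForm k τ ω)
    (hηw : IsWord n k η) (hstdη : StdForm k τ η)
    (hout : ∀ s, s ∉ Finset.Icc 1 k → η s = ω s)
    (hηQ : ∀ a r, countPairs k τ η a r =
      cnt ((rsk (bwList k τ ω)).2).length (tabEntry ((rsk (bwList k τ ω)).2)) a r) :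
    HighestOf n k ω η := by
  obtain ⟨v, hv, hvw, hvstd, hvQ, hvout⟩ := exists_highestOf hω hstd
  obtain rfl : η = v := by
    funext s
    by_cases hs : s ∈ Finset.Icc 1 k
    · refine hstdη.eq_of_countPairs_eq hvstd (fun a r => ?_) hs
      rw [hηQ, hv.countPairs_eq_cnt hvw, hvQ]
    · rw [hout s hs, hvout s hs]
  exact hv
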